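/- Let ℰ be a nonempty set of tiles such that for every T ∈ ℰ the pair (B_1^ℰ(T),T) is a 1-configuration, and such that the pairs (B_1^ℰ(T),T), T ∈ ℰ, fall into finitely many isomorphism classes. Then: (1) the tiles of ℰ cover E, and for each x ∈ E and each η > 0 the set {S ∈ ℰ : S ∩ β(x,η) ≠ ∅} is finite; (2) if moreover (E,δ) is weakly homogeneous, then for each η > 0 there exists r ≥ 1 such that for all S,T ∈ ℰ, inf{δ(s,t) : s ∈ S, t ∈ T} ≤ η implies T ∈ B_r^ℰ(S). (Proposition 1.2) -/

import Mathlib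

open Set Metric

namespace Paper

variable {E : Type*} [MetricSpace E]

/-- Image of a tile under an isometry (right action of `σ` on tiles). -/
def tmap (σ : E ≃ᵢ E) (T : Set E) : Set E := σ '' T

/-- Image of a set of tiles under an isometry. -/
def smap (σ : E ≃ᵢ E) (ℰ : Set (Set E)) : Set (Set E) := tmap σ '' ℰ

/-- `bt ℰ T n` is the set `B_n^ℰ(T)` of tiles of `ℰ` at combinatorial distance at most `n`
from `T`. -/
def bt (ℰ : Set (Set E)) (T : Set E) : ℕ → Set (Set E)
  | 0 => {T}
  | n + 1 => {U | U ∈ ℰ ∧ ∃ V ∈ bt ℰ T n, (U ∩ V).Nonempty}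

/-- A tile is a closed bounded subset of `E`. -/
def IsTile (T : Set E) : Prop := IsClosed T ∧ Bornology.IsBounded T

variable (G : Subgroup (E ≃ᵢ E))

/-- `(ℰ,T) ≅ (ℰ',T')` modulo `G`. -/
def PIso (ℰ : Set (Set E)) (T : Set E) (ℰ' : Set (Set E)) (T' : Set E) : Prop :=
  ∃ σ ∈ G, smap σ ℰ = ℰ' ∧ tmap σ T = T'

/-- `(ℰ,T) ≤ (ℰ',T')` modulo `G`. -/
def PLe (ℰ : Set (Set E)) (T : Set E) (ℰ' : Set (Set E)) (T' : Set E) : Prop :=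
  ∃ σ ∈ G, smap σ ℰ ⊆ ℰ' ∧ tmap σ T = T'

/-- A `p`-configuration. -/
def IsConfig (p : ℕ) (ℰ : Set (Set E)) (T : Set E) : Prop :=
  ℰ.Finite ∧ T ∈ ℰ ∧ (∀ S ∈ ℰ, IsTile S) ∧ bt ℰ T p = ℰ ∧
    ∀ S ∈ bt ℰ T (p - 1), S ⊆ interior (⋃₀ (bt ℰ S 1))

/-- A `p`-local rule: a finite family of pairwise nonisomorphic `p`-configurations
satisfying the two compatibility conditions. -/
structure LocalRule (E : Type*) [MetricSpace E] (G : Subgroup (E ≃ᵢ E)) where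
  p : ℕ
  hp : 1 ≤ p
  m : ℕ
  C : Fin m → Set (Set E)
  c : Fin m → Set E
  config : ∀ i, IsConfig p (C i) (c i)
  nonIso : ∀ i j, i ≠ j → ¬ PIso G (C i) (c i) (C j) (c j)
  cond1 : ∀ i j, PLe G (bt (C i) (c i) 1) (c i) (bt (C j) (c j) 1) (c j) →
    PIso G (bt (C i) (c i) 1) (c i) (bt (C j) (c j) 1) (c j)
  cond2 : ∀ i, ∀ S ∈ bt (C i) (c i) 1, ∃ j,
    PIso G (bt (C i) S (p - 1)) S (bt (C j) (c j) (p - 1)) (c j)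

/-- A set of tiles satisfies a local rule `Γ` if each `(B_p^ℰ(T),T)` is isomorphic
to one of the configurations of `Γ`. -/
def Satisfies (Γ : LocalRule E G) (ℰ : Set (Set E)) : Prop :=
  ∀ T ∈ ℰ, ∃ i, PIso G (bt ℰ T Γ.p) T (Γ.C i) (Γ.c i)

/-- The pairs `(B_r^ℰ(T),T)`, `T ∈ ℰ`, fall into finitely many isomorphism classes. -/
def FinClasses (ℰ : Set (Set E)) (r : ℕ) : Prop :=
  ∃ 𝒜 : Set (Set E), 𝒜.Finite ∧ 𝒜 ⊆ ℰ ∧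
    ∀ T ∈ ℰ, ∃ S ∈ 𝒜, PIso G (bt ℰ S r) S (bt ℰ T r) T

/-- A tiling of `E`. -/
def IsTiling (𝒯 : Set (Set E)) : Prop :=
  (∀ T ∈ 𝒯, IsTile T) ∧ ⋃₀ 𝒯 = univ ∧
    ∀ r : ℕ, 1 ≤ r →
      (∀ T ∈ 𝒯, (bt 𝒯 T r).Finite ∧ ⋃₀ (bt 𝒯 T (r - 1)) ⊆ interior (⋃₀ (bt 𝒯 T r))) ∧
      (∀ S ∈ 𝒯, ∀ T ∈ 𝒯, PLe G (bt 𝒯 S r) S (bt 𝒯 T r) T →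
        PIso G (bt 𝒯 S r) S (bt 𝒯 T r) T) ∧
      FinClasses G 𝒯 r

/-- Standing hypothesis on the `q`-local rule `Δ`: no nontrivial element of `G` fixes all
the tiles of some `B_{q-1}^{𝒟_i}(D_i)`. -/
def RigidRule (Δ : LocalRule E G) : Prop :=
  ∀ i, ∀ σ ∈ G, (∀ T ∈ bt (Δ.C i) (Δ.c i) (Δ.p - 1), tmap σ T = T) → σ = 1

/-- A patch. -/
def IsPatch (ℰ : Set (Set E)) : Prop :=
  ∀ S ∈ ℰ, ∀ T ∈ ℰ, ∃ r : ℕ, T ∈ bt ℰ S r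

/-- `I_Γ(ℰ)`. -/
def IRule (Γ : LocalRule E G) (ℰ : Set (Set E)) : Set (Set E) :=
  {T | T ∈ ℰ ∧ ∃ i, PIso G (bt ℰ T Γ.p) T (Γ.C i) (Γ.c i)}

/-- A `Γ`-patch. -/
def IsRulePatch (Γ : LocalRule E G) (ℰ : Set (Set E)) : Prop :=
  (∀ T ∈ ℰ, ∃ i, PLe G (bt ℰ T Γ.p) T (Γ.C i) (Γ.c i)) ∧
    ∃ 𝒜 ⊆ IRule G Γ ℰ, IsPatch 𝒜 ∧ ℰ = ⋃ T ∈ 𝒜, bt ℰ T Γ.p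

/-- The local isomorphism property for a tiling. -/
def TilingLIP (𝒯 : Set (Set E)) : Prop :=
  ∀ ℰ ⊆ 𝒯, IsPatch ℰ → ℰ.Finite →
    ∃ k : ℕ, 1 ≤ k ∧ ∀ T ∈ 𝒯, ∃ σ ∈ G, smap σ ℰ ⊆ bt 𝒯 T k

/-- `𝒮 ⋐ 𝒯` for tilings: each finite subpatch of `𝒮` is isomorphic to a subpatch of `𝒯`. -/
def TSub (𝒮 𝒯 : Set (Set E)) : Prop :=
  ∀ ℰ ⊆ 𝒮, IsPatch ℰ → ℰ.Finite →
    ∃ ℱ ⊆ 𝒯, IsPatch ℱ ∧ ∃ σ ∈ G, smap σ ℰ = ℱ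

/-- Locally isomorphic tilings. -/
def TLocIso (𝒮 𝒯 : Set (Set E)) : Prop := TSub G 𝒮 𝒯 ∧ TSub G 𝒯 𝒮

/-- A rigid tiling: no nontrivial element of `G` leaves it globally invariant. -/
def TRigid (𝒯 : Set (Set E)) : Prop := ∀ σ ∈ G, smap σ 𝒯 = 𝒯 → σ = 1

/-- `β(x,ξ,n)`: the `n`-th iterated union of closed balls of radius `ξ` starting at `x`. -/
def iterBall (x : E) (ξ : ℝ) : ℕ → Set E
  | 0 => {x}
  | n + 1 => ⋃ y ∈ iterBall x ξ n, closedBall y ξ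

/-- `ω(x,ξ,n) = sup {η ≥ 0 : β(x,η) ⊆ β(x,ξ,n)}`. -/
noncomputable def omegaBall (x : E) (ξ : ℝ) (n : ℕ) : ℝ :=
  sSup {η : ℝ | 0 ≤ η ∧ closedBall x η ⊆ iterBall x ξ n}

/-- `(E,δ)` is weakly homogeneous if `inf_x ω(x,ξ,n)` tends to infinity with `n`. -/
def WeaklyHomogeneous (E : Type*) [MetricSpace E] : Prop :=
  ∀ ξ : ℝ, 0 < ξ →
    Filter.Tendsto (fun n : ℕ => ⨅ x : E, omegaBall x ξ n) Filter.atTop Filter.atTop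

omit [MetricSpace E] in
lemma mem_of_mem_bt {ℰ : Set (Set E)} {T U : Set E} (hT : T ∈ ℰ) {n : ℕ}
    (hU : U ∈ bt ℰ T n) : U ∈ ℰ := by
  cases n with
  | zero => exact (show U = T from hU) ▸ hT
  | succ n => exact hU.1

omit [MetricSpace E] in
lemma mem_bt_one {ℰ : Set (Set E)} {T U : Set E} :
    U ∈ bt ℰ T 1 ↔ U ∈ ℰ ∧ (U ∩ T).Nonempty := by
  simp [bt]

omit [MetricSpace E] in
lemma bt_succ_finite {ℰ : Set (Set E)} (hfin : ∀ T ∈ ℰ, (bt ℰ T 1).Finite) {T : Set E}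
    (hT : T ∈ ℰ) {n : ℕ} (hn : (bt ℰ T n).Finite) : (bt ℰ T (n + 1)).Finite := by
  refine (hn.biUnion fun V hV => hfin V (mem_of_mem_bt hT hV)).subset ?_
  rintro U ⟨hU, V, hV, hUV⟩
  exact mem_iUnion₂.2 ⟨V, hV, mem_bt_one.2 ⟨hU, hUV⟩⟩

lemma sUnion_smap (σ : E ≃ᵢ E) (ℰ : Set (Set E)) : ⋃₀ smap σ ℰ = σ '' ⋃₀ ℰ :=
  (image_sUnion ..).symm

namespace IsConfig

variable {ℰ : Set (Set E)} {T : Set E}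

lemma nonempty_of_bt (h : IsConfig 1 (bt ℰ T 1) T) : T.Nonempty := by
  simpa using (mem_bt_one.1 h.2.1).2

lemma subset_interior_of_bt (h : IsConfig 1 (bt ℰ T 1) T) :
    T ⊆ interior (⋃₀ bt ℰ T 1) := by
  obtain ⟨-, -, -, hbt, hint⟩ := h
  simpa only [hbt] using hint T rfl

lemma exists_closedBall_subset [ProperSpace E] (h : IsConfig 1 (bt ℰ T 1) T) :
    ∃ ξ > 0, ∀ x ∈ T, closedBall x ξ ⊆ ⋃₀ bt ℰ T 1 := by
  obtain ⟨hcl, hbd⟩ := h.2.2.1 T h.2.1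
  obtain ⟨ξ, hξ, hsub⟩ := (isCompact_of_isClosed_isBounded hcl hbd).exists_cthickening_subset_open
    isOpen_interior h.subset_interior_of_bt
  exact ⟨ξ, hξ, fun x hx =>
    (closedBall_subset_cthickening hx ξ).trans (hsub.trans interior_subset)⟩

end IsConfig

lemma PIso.closedBall_subset {G : Subgroup (E ≃ᵢ E)} {ℰ ℰ' : Set (Set E)} {T T' : Set E}
    (h : PIso G ℰ T ℰ' T') {ξ : ℝ} (hξ : ∀ x ∈ T, closedBall x ξ ⊆ ⋃₀ ℰ) :
    ∀ x ∈ T', closedBall x ξ ⊆ ⋃₀ ℰ' := by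
  obtain ⟨σ, -, rfl, rfl⟩ := h
  rintro _ ⟨x, hx, rfl⟩
  rw [sUnion_smap, ← IsometryEquiv.image_closedBall]
  exact image_mono (hξ x hx)

lemma exists_uniform_closedBall_subset [ProperSpace E] {G : Subgroup (E ≃ᵢ E)}
    {ℰ : Set (Set E)} (hconf : ∀ T ∈ ℰ, IsConfig 1 (bt ℰ T 1) T) (hfin : FinClasses G ℰ 1) :
    ∃ ξ > 0, ∀ T ∈ ℰ, ∀ x ∈ T, closedBall x ξ ⊆ ⋃₀ bt ℰ T 1 := by
  obtain ⟨𝒜, h𝒜, h𝒜ℰ, hiso⟩ := hfin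
  have huniform : ∃ ξ > 0, ∀ S ∈ 𝒜, ∀ x ∈ S, closedBall x ξ ⊆ ⋃₀ bt ℰ S 1 := by
    clear hiso
    induction 𝒜, h𝒜 using Set.Finite.induction_on with
    | empty => exact ⟨1, one_pos, by simp⟩
    | @insert S 𝒜 _ _ ih =>
      obtain ⟨ξ, hξ, h⟩ := ih ((subset_insert _ _).trans h𝒜ℰ)
      obtain ⟨ζ, hζ, h'⟩ := (hconf S (h𝒜ℰ (mem_insert _ _))).exists_closedBall_subset
      refine ⟨min ξ ζ, lt_min hξ hζ, ?_⟩
      rintro T (rfl | hT) x hx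
      · exact (closedBall_subset_closedBall (min_le_right _ _)).trans (h' x hx)
      · exact (closedBall_subset_closedBall (min_le_left _ _)).trans (h T hT x hx)
  obtain ⟨ξ, hξ, h⟩ := huniform
  refine ⟨ξ, hξ, fun T hT => ?_⟩
  obtain ⟨S, hS, hST⟩ := hiso T hT
  exact hST.closedBall_subset (h S hS)

section UniformRadius

variable {ℰ : Set (Set E)} {ξ : ℝ}

lemma sUnion_eq_univ_of_closedBall_subset [ConnectedSpace E] (hξ : 0 < ξ)
    (h : ∀ T ∈ ℰ, ∀ x ∈ T, closedBall x ξ ⊆ ⋃₀ bt ℰ T 1) (hne : (⋃₀ ℰ).Nonempty) :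
    ⋃₀ ℰ = univ := by
  have hball : ∀ x ∈ ⋃₀ ℰ, closedBall x ξ ⊆ ⋃₀ ℰ := by
    rintro x ⟨T, hT, hx⟩
    exact (h T hT x hx).trans (sUnion_mono fun U hU => (mem_bt_one.1 hU).1)
  refine IsClopen.eq_univ ⟨?_, ?_⟩ hne
  · refine isClosed_of_closure_subset fun x hx => ?_
    obtain ⟨y, hy, hxy⟩ := Metric.mem_closure_iff.1 hx ξ hξ
    exact hball y hy (mem_closedBall.2 hxy.le)
  · exact Metric.isOpen_iff.2 fun x hx => ⟨ξ, hξ, ball_subset_closedBall.trans (hball x hx)⟩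

lemma mem_bt_two_of_inter_closedBall_nonempty
    (h : ∀ T ∈ ℰ, ∀ x ∈ T, closedBall x ξ ⊆ ⋃₀ bt ℰ T 1) {S T : Set E} (hS : S ∈ ℰ)
    (hT : T ∈ ℰ) {x : E} (hx : x ∈ T) (hne : (S ∩ closedBall x ξ).Nonempty) :
    S ∈ bt ℰ T 2 := by
  obtain ⟨y, hyS, hy⟩ := hne
  obtain ⟨V, hV, hyV⟩ := h T hT x hx hy
  exact ⟨hS, V, hV, y, hyS, hyV⟩

lemma locallyFinite_of_closedBall_subset (hξ : 0 < ξ)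
    (h : ∀ T ∈ ℰ, ∀ x ∈ T, closedBall x ξ ⊆ ⋃₀ bt ℰ T 1)
    (hfin : ∀ T ∈ ℰ, (bt ℰ T 1).Finite) (hcov : ⋃₀ ℰ = univ) :
    LocallyFinite (fun S : ℰ => (S : Set E)) := by
  intro x
  obtain ⟨T, hT, hx⟩ : x ∈ ⋃₀ ℰ := hcov ▸ mem_univ x
  refine ⟨closedBall x ξ, closedBall_mem_nhds x hξ, ?_⟩
  refine ((bt_succ_finite hfin hT (hfin T hT)).preimage Subtype.val_injective.injOn).subset ?_
  exact fun S hS => mem_bt_two_of_inter_closedBall_nonempty h S.2 hT hx hS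

lemma iterBall_subset_sUnion_bt (h : ∀ T ∈ ℰ, ∀ x ∈ T, closedBall x ξ ⊆ ⋃₀ bt ℰ T 1)
    {S : Set E} (hS : S ∈ ℰ) {s : E} (hs : s ∈ S) (n : ℕ) :
    iterBall s ξ n ⊆ ⋃₀ bt ℰ S n := by
  induction n with
  | zero => rintro _ rfl; exact ⟨S, rfl, hs⟩
  | succ n ih =>
    intro z hz
    obtain ⟨y, hy, hz⟩ := mem_iUnion₂.1 hz
    obtain ⟨V, hV, hyV⟩ := ih hy
    obtain ⟨W, hW, hzW⟩ := h V (mem_of_mem_bt hS hV) y hyV hz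
    obtain ⟨hWℰ, hWV⟩ := mem_bt_one.1 hW
    exact ⟨W, ⟨hWℰ, V, hV, hWV⟩, hzW⟩

end UniformRadius

lemma omegaBall_nonneg (x : E) (ξ : ℝ) (n : ℕ) : 0 ≤ omegaBall x ξ n :=
  Real.sSup_nonneg fun _ h => h.1

lemma closedBall_subset_iterBall_of_lt_omegaBall {x : E} {ξ ρ : ℝ} {n : ℕ} (hρ : 0 ≤ ρ)
    (h : ρ < omegaBall x ξ n) : closedBall x ρ ⊆ iterBall x ξ n := by
  have hne : {η : ℝ | 0 ≤ η ∧ closedBall x η ⊆ iterBall x ξ n}.Nonempty := by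
    by_contra hempty
    rw [omegaBall, not_nonempty_iff_eq_empty.1 hempty, Real.sSup_empty] at h
    exact hρ.not_gt h
  obtain ⟨η, hη, hlt⟩ := exists_lt_of_lt_csSup hne h
  exact (closedBall_subset_closedBall hlt.le).trans hη.2

lemma WeaklyHomogeneous.exists_closedBall_subset_iterBall (hE : WeaklyHomogeneous E) {ξ ρ : ℝ}
    (hξ : 0 < ξ) (hρ : 0 ≤ ρ) : ∃ n, ∀ x : E, closedBall x ρ ⊆ iterBall x ξ n := by
  obtain ⟨n, hn⟩ := ((hE ξ hξ).eventually_gt_atTop ρ).exists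
  refine ⟨n, fun x => closedBall_subset_iterBall_of_lt_omegaBall hρ (hn.trans_le ?_)⟩
  exact ciInf_le ⟨0, forall_mem_range.2 fun x => omegaBall_nonneg x ξ n⟩ x

lemma exists_dist_lt_of_sInf_image2_dist_lt {S T : Set E} (hS : S.Nonempty) (hT : T.Nonempty)
    {ρ : ℝ} (h : sInf (image2 dist S T) < ρ) : ∃ s ∈ S, ∃ t ∈ T, dist s t < ρ := by
  obtain ⟨_, ⟨s, hs, t, ht, rfl⟩, hlt⟩ := exists_lt_of_csInf_lt (hS.image2 hT) h
  exact ⟨s, hs, t, ht, hlt⟩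

/-- **Proposition 1.2.** Let `ℰ` be a nonempty set of tiles such that the pairs
`(B_1^ℰ(T),T)` are `1`-configurations and fall into finitely many isomorphism classes.
Then (1) `ℰ` covers `E` and only finitely many tiles of `ℰ` meet any closed ball;
(2) if `(E,δ)` is weakly homogeneous then for each `η > 0` there is `r ≥ 1` such that
`δ(S,T) ≤ η` implies `T ∈ B_r^ℰ(S)`. -/
theorem prop_1_2 {E : Type*} [MetricSpace E] [ConnectedSpace E]
    (hcomp : ∀ (x : E) (η : ℝ), IsCompact (Metric.closedBall x η))
    (G : Subgroup (E ≃ᵢ E))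
    (ℰ : Set (Set E)) (hne : ℰ.Nonempty)
    (hconf : ∀ T ∈ ℰ, IsConfig 1 (bt ℰ T 1) T)
    (hfin : ∃ 𝒜 : Set (Set E), 𝒜.Finite ∧ 𝒜 ⊆ ℰ ∧
      ∀ T ∈ ℰ, ∃ S ∈ 𝒜, PIso G (bt ℰ S 1) S (bt ℰ T 1) T) :
    (⋃₀ ℰ = univ ∧ ∀ (x : E) (η : ℝ), 0 < η →
        {S | S ∈ ℰ ∧ (S ∩ closedBall x η).Nonempty}.Finite) ∧
      (WeaklyHomogeneous E → ∀ η : ℝ, 0 < η → ∃ r : ℕ, 1 ≤ r ∧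
        ∀ S ∈ ℰ, ∀ T ∈ ℰ, sInf (Set.image2 dist S T) ≤ η → T ∈ bt ℰ S r) := by
  have : ProperSpace E := ⟨hcomp⟩
  obtain ⟨ξ, hξ, h⟩ := exists_uniform_closedBall_subset hconf hfin
  have hT_ne : ∀ T ∈ ℰ, T.Nonempty := fun T hT => (hconf T hT).nonempty_of_bt
  have hbt_fin : ∀ T ∈ ℰ, (bt ℰ T 1).Finite := fun T hT => (hconf T hT).1
  have hcov : ⋃₀ ℰ = univ := by
    obtain ⟨T, hT⟩ := hne
    exact sUnion_eq_univ_of_closedBall_subset hξ h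
      ((hT_ne T hT).mono (subset_sUnion_of_mem hT))
  refine ⟨⟨hcov, fun x η _ => ?_⟩, fun hE η hη => ?_⟩
  · have hlf := locallyFinite_of_closedBall_subset hξ h hbt_fin hcov
    refine ((hlf.finite_nonempty_inter_compact (hcomp x η)).image Subtype.val).subset ?_
    exact fun S hS => ⟨⟨S, hS.1⟩, hS.2, rfl⟩
  · obtain ⟨n, hn⟩ := hE.exists_closedBall_subset_iterBall hξ (by positivity : 0 ≤ η + 1)
    refine ⟨n + 1, Nat.le_add_left 1 n, fun S hS T hT hST => ?_⟩
    obtain ⟨s, hs, t, ht, hst⟩ := exists_dist_lt_of_sInf_image2_dist_lt (hT_ne S hS) (hT_ne T hT)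
      (hST.trans_lt (lt_add_one η))
    obtain ⟨V, hV, htV⟩ := iterBall_subset_sUnion_bt h hS hs n
      (hn s (mem_closedBall'.2 hst.le))
    exact ⟨hT, V, hV, t, ht, htV⟩

end Paper
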